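/- Let M ≥ 1 and K ≥ M+1 be integers, L > 0, α_g ≥ 0, k_g ∈ ℝ, and set ϖ = (1/√2)·exp(−(α_g + i k_g)·L/(M+1)). Let Q(ϖ) denote the M × (M+1) complex matrix with entries [Q(ϖ)]_{m,n} = ϖ^{m−n+1} if 1 ≤ n ≤ m and [Q(ϖ)]_{m,n} = ϖ^{n−m} if m < n ≤ M+1. If H is a K × (M+1) complex matrix of rank M+1, then the effective channel H_eff = H · Q(ϖ)ᵀ has rank M = min{M, K}. -/

import Mathlib

/-- the case K ≥ M+1 of Theorem 1 (DoF = min{M,K} for C-PASS). If the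
free-space channel H (K × (M+1)) has full rank M+1, the effective channel
H_eff = H Q(ϖ)ᵀ has rank M = min{M,K}. -/
theorem stmt_2 (M K : ℕ) (hM : 1 ≤ M) (hK : M + 1 ≤ K) (L αg kg : ℝ)
    (hL : 0 < L) (hα : 0 ≤ αg)
    (ϖ : ℂ)
    (hϖ : ϖ = ((1 / Real.sqrt 2 : ℝ) : ℂ) *
      Complex.exp (-((αg : ℂ) + (kg : ℂ) * Complex.I) * (L : ℂ) / ((M : ℂ) + 1)))
    (Q : Matrix (Fin M) (Fin (M + 1)) ℂ)
    (hQ : ∀ (m : Fin M) (n : Fin (M + 1)), Q m n =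
      if (n : ℕ) ≤ (m : ℕ) then ϖ ^ ((m : ℕ) - (n : ℕ) + 1) else ϖ ^ ((n : ℕ) - (m : ℕ)))
    (H : Matrix (Fin K) (Fin (M + 1)) ℂ) (hH : H.rank = M + 1) :
    (H * Q.transpose).rank = M ∧ M = min M K := by
  refine ⟨?_, by omega⟩
  have h0 : ϖ ≠ 0 := by
    rw [hϖ]
    refine mul_ne_zero ?_ (Complex.exp_ne_zero _)
    rw [Complex.ofReal_ne_zero]
    positivity
  have h1 : ϖ ≠ 1 := by
    intro h
    have hn : ‖ϖ‖ = 1 := by rw [h]; simp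
    have hre : (-((αg : ℂ) + (kg : ℂ) * Complex.I) * (L : ℂ) / ((M : ℂ) + 1))
        = ((-(αg * L / ((M : ℝ) + 1)) : ℝ) : ℂ)
          + ((-(kg * L / ((M : ℝ) + 1)) : ℝ) : ℂ) * Complex.I := by
      push_cast
      ring
    rw [hϖ, norm_mul, Complex.norm_exp, hre, Complex.norm_real, Complex.add_re,
      Complex.re_ofReal_mul, Complex.ofReal_re, Complex.I_re, mul_zero, add_zero] at hn
    have ha : Real.exp (-(αg * L / ((M : ℝ) + 1))) ≤ 1 := by
      rw [Real.exp_le_one_iff, neg_nonpos]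
      positivity
    have hb : ‖(1 / Real.sqrt 2 : ℝ)‖ < 1 := by
      rw [Real.norm_of_nonneg (by positivity), div_lt_one (by positivity)]
      exact Real.lt_sqrt_of_sq_lt (by norm_num)
    have := Real.exp_pos (-(αg * L / ((M : ℝ) + 1)))
    nlinarith [norm_nonneg (1 / Real.sqrt 2 : ℝ)]
  have hQinj : ∀ c : Fin M → ℂ, Q.transpose.mulVec c = 0 → c = 0 := by
    intro c hc
    have key : ∀ k : ℕ, ∀ hk : k < M, c ⟨k, hk⟩ = 0 := by
      intro k
      induction k using Nat.strong_induction_on with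
      | _ k ih =>
        intro hk
        have e1 := congrFun hc ⟨k, by omega⟩
        have e2 := congrFun hc ⟨k + 1, by omega⟩
        simp only [Matrix.mulVec, dotProduct, Matrix.transpose_apply, Pi.zero_apply] at e1 e2
        have e3 : ∑ m : Fin M, (Q m ⟨k, by omega⟩ - ϖ * Q m ⟨k + 1, by omega⟩) * c m = 0 := by
          simp only [sub_mul, Finset.sum_sub_distrib, mul_assoc, ← Finset.mul_sum]
          rw [e1, e2]; simp
        rw [Finset.sum_eq_single (⟨k, hk⟩ : Fin M)] at e3
        · simp only [hQ] at e3
          simp at e3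
          rcases e3 with e3 | e3
          · exfalso
            have : ϖ * (1 - ϖ) = 0 := by linear_combination e3
            rcases mul_eq_zero.mp this with h | h
            · exact h0 h
            · exact h1 (sub_eq_zero.mp h).symm
          · exact e3
        · intro m _ hm
          have hne : (m : ℕ) ≠ k := fun h => hm (Fin.ext h)
          rcases lt_or_gt_of_ne hne with h | h
          · have := ih m h m.2
            simp only [Fin.eta] at this
            rw [this, mul_zero]
          · simp only [hQ]
            rw [if_pos (by omega), if_pos (by omega), ← pow_succ',
              show (m : ℕ) - (k + 1) + 1 + 1 = m - k + 1 by omega]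
            simp
        · simp
    funext i
    exact key i i.2
  have hHinj : Function.Injective H.mulVecLin := by
    rw [← LinearMap.ker_eq_bot]
    have := LinearMap.finrank_range_add_finrank_ker H.mulVecLin
    have hr : Module.finrank ℂ (LinearMap.range H.mulVecLin) = M + 1 := hH
    rw [hr, Module.finrank_fin_fun] at this
    exact Submodule.finrank_eq_zero.mp (by omega)
  have hinj : Function.Injective (H * Q.transpose).mulVecLin := by
    rw [Matrix.mulVecLin_mul]
    refine hHinj.comp ?_
    rw [← LinearMap.ker_eq_bot, LinearMap.ker_eq_bot']
    exact hQinj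
  have := LinearMap.finrank_range_of_inj hinj
  rw [Module.finrank_fin_fun] at this
  exact this
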